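/- arXiv:2012.06555 — 3 statements merged into one kernel-verified Lean document; each statement's English description precedes it below -/
import Mathlib

section
/- (Soft Policy Improvement) Let π_old and π_new be full-support policies, and let Q^{π_old} be the soft Q-function of π_old. If for every state s, ∑_a π_new(a|s)·(α log π_new(a|s) − Q^{π_old}(s,a)) ≤ ∑_a π_old(a|s)·(α log π_old(a|s) − Q^{π_old}(s,a)) (this holds in particular when π_new minimizes, over a set Π of full-support policies containing π_old, the KL divergence D_KL(π'(·|s) ‖ exp(Q^{π_old}(s,·)/α)/Z(s)) for every state s), then Q^{π_new}(s,a) ≥ Q^{π_old}(s,a) for all (s,a) ∈ S × A. -/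
open scoped BigOperators

/-- The soft Bellman backup operator `T^π`:
`(T^π Q)(s,a) = r(s,a) + γ ∑_{s'} p(s'|s,a) ∑_{a'} π(a'|s') (Q(s',a') − α log π(a'|s'))`. -/
noncomputable def softBellman {S A : Type*} [Fintype S] [Fintype A]
    (p : S → A → S → ℝ) (r : S → A → ℝ) (γ α : ℝ) (π : S → A → ℝ)
    (Q : S → A → ℝ) : S → A → ℝ :=
  fun s a =>
    r s a + γ * ∑ s', p s a s' * ∑ a', π s' a' * (Q s' a' - α * Real.log (π s' a'))

/-- Soft Policy Improvement: if for every state the new policy has a smaller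
soft-improvement objective against `Q^{π_old}`, then `Q^{π_new} ≥ Q^{π_old}` pointwise.
Here `Qold` and `Qnew` are the soft Q-functions, i.e. the fixed points of the corresponding
soft Bellman backup operators. -/
theorem soft_policy_improvement {S A : Type*} [Fintype S] [Fintype A]
    [Nonempty S] [Nonempty A]
    (p : S → A → S → ℝ) (r : S → A → ℝ) (γ α : ℝ)
    (πold πnew : S → A → ℝ)
    (hp_nonneg : ∀ s a s', 0 ≤ p s a s')
    (hp_sum : ∀ s a, ∑ s', p s a s' = 1)
    (hγ0 : 0 ≤ γ) (hγ1 : γ < 1) (hα : 0 ≤ α)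
    (hπold_pos : ∀ s a, 0 < πold s a)
    (hπold_sum : ∀ s, ∑ a, πold s a = 1)
    (hπnew_pos : ∀ s a, 0 < πnew s a)
    (hπnew_sum : ∀ s, ∑ a, πnew s a = 1)
    (Qold Qnew : S → A → ℝ)
    (hQold : softBellman p r γ α πold Qold = Qold)
    (hQnew : softBellman p r γ α πnew Qnew = Qnew)
    (himp : ∀ s,
      ∑ a, πnew s a * (α * Real.log (πnew s a) - Qold s a) ≤
        ∑ a, πold s a * (α * Real.log (πold s a) - Qold s a)) :
    ∀ s a, Qold s a ≤ Qnew s a := by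
  obtain ⟨⟨s0, a0⟩, hmax⟩ := Finite.exists_max (fun x : S × A => Qold x.1 x.2 - Qnew x.1 x.2)
  have hin : ∀ s', ∑ a', πold s' a' * (Qold s' a' - α * Real.log (πold s' a')) ≤
      ∑ a', πnew s' a' * (Qnew s' a' - α * Real.log (πnew s' a'))
        + (Qold s0 a0 - Qnew s0 a0) := by
    intro s'
    have h1 : ∑ a', πnew s' a' * (Qold s' a' - Qnew s' a') ≤ Qold s0 a0 - Qnew s0 a0 := by
      calc _ ≤ ∑ a', πnew s' a' * (Qold s0 a0 - Qnew s0 a0) :=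
            Finset.sum_le_sum fun a' _ =>
              mul_le_mul_of_nonneg_left (hmax (s', a')) (hπnew_pos s' a').le
        _ = _ := by rw [← Finset.sum_mul, hπnew_sum, one_mul]
    have h2 := himp s'
    simp only [mul_sub, Finset.sum_sub_distrib] at h1 h2 ⊢
    linarith
  have hout : ∑ s', p s0 a0 s' * ∑ a', πold s' a' * (Qold s' a' - α * Real.log (πold s' a')) ≤
      ∑ s', p s0 a0 s' * ∑ a', πnew s' a' * (Qnew s' a' - α * Real.log (πnew s' a'))
        + (Qold s0 a0 - Qnew s0 a0) := by
    calc _ ≤ ∑ s', p s0 a0 s' * (∑ a', πnew s' a' * (Qnew s' a' - α * Real.log (πnew s' a'))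
          + (Qold s0 a0 - Qnew s0 a0)) :=
          Finset.sum_le_sum fun s' _ => mul_le_mul_of_nonneg_left (hin s') (hp_nonneg s0 a0 s')
      _ = _ := by
        simp only [mul_add, Finset.sum_add_distrib]
        rw [← Finset.sum_mul, hp_sum, one_mul]
  have ho := congrFun (congrFun hQold s0) a0
  have hn := congrFun (congrFun hQnew s0) a0
  unfold softBellman at ho hn
  have h3 := mul_le_mul_of_nonneg_left hout hγ0
  rw [mul_add] at h3
  have h4 : Qold s0 a0 - Qnew s0 a0 ≤ γ * (Qold s0 a0 - Qnew s0 a0) := by linarith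
  have h5 : Qold s0 a0 - Qnew s0 a0 ≤ 0 := by
    by_contra hc
    push Not at hc
    nlinarith
  intro s a
  have h6 := hmax (s, a)
  simp only at h6
  linarith
end

section
/- (Soft Policy Iteration, monotone convergence part) Let (π_k)_{k≥0} be a sequence of full-support policies such that for every k and every state s, ∑_a π_{k+1}(a|s)·(α log π_{k+1}(a|s) − Q^{π_k}(s,a)) ≤ ∑_a π_k(a|s)·(α log π_k(a|s) − Q^{π_k}(s,a)). Then the sequence of soft Q-functions is pointwise nondecreasing, i.e., Q^{π_{k+1}}(s,a) ≥ Q^{π_k}(s,a) for all k and all (s,a), it is uniformly bounded above, and hence Q^{π_k}(s,a) converges as k → ∞ for every (s,a) ∈ S × A. -/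
open scoped BigOperators

theorem aux_max {S A : Type*} [Fintype S] [Fintype A] [Nonempty S] [Nonempty A]
    (p : S → A → S → ℝ) (γ c : ℝ) (π : S → A → ℝ) (D : S → A → ℝ)
    (hp_nonneg : ∀ s a s', 0 ≤ p s a s')
    (hp_sum : ∀ s a, ∑ s', p s a s' = 1)
    (hγ0 : 0 ≤ γ) (hγ1 : γ < 1)
    (hπ_pos : ∀ s a, 0 < π s a)
    (hπ_sum : ∀ s, ∑ a, π s a = 1)
    (hD : ∀ s a, D s a ≤ c + γ * ∑ s', p s a s' * ∑ a', π s' a' * D s' a') :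
    ∀ s a, D s a ≤ c / (1 - γ) := by
  obtain ⟨⟨s0, a0⟩, h0⟩ := Finite.exists_max (fun x : S × A => D x.1 x.2)
  have h1 : ∀ s', ∑ a', π s' a' * D s' a' ≤ D s0 a0 := by
    intro s'
    calc ∑ a', π s' a' * D s' a' ≤ ∑ a', π s' a' * D s0 a0 :=
          Finset.sum_le_sum fun a' _ =>
            mul_le_mul_of_nonneg_left (h0 (s', a')) (hπ_pos s' a').le
      _ = D s0 a0 := by rw [← Finset.sum_mul, hπ_sum, one_mul]
  have h2 : ∑ s', p s0 a0 s' * ∑ a', π s' a' * D s' a' ≤ D s0 a0 := by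
    calc _ ≤ ∑ s', p s0 a0 s' * D s0 a0 :=
          Finset.sum_le_sum fun s' _ =>
            mul_le_mul_of_nonneg_left (h1 s') (hp_nonneg s0 a0 s')
      _ = D s0 a0 := by rw [← Finset.sum_mul, hp_sum, one_mul]
  have h3 := hD s0 a0
  have h4 := mul_le_mul_of_nonneg_left h2 hγ0
  intro s a
  refine (h0 (s, a)).trans ?_
  rw [le_div_iff₀ (by linarith)]
  simp only
  linarith

/-- Soft Policy Iteration, monotone convergence part: along a soft policy
iteration sequence of full-support policies, the soft Q-functions (fixed points of the
corresponding soft Bellman backup operators) are pointwise nondecreasing, uniformly bounded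
above, and hence pointwise convergent. -/
theorem soft_policy_iteration_monotone_convergence
    {S A : Type*} [Fintype S] [Fintype A] [Nonempty S] [Nonempty A]
    (p : S → A → S → ℝ) (r : S → A → ℝ) (γ α : ℝ)
    (π : ℕ → S → A → ℝ) (Q : ℕ → S → A → ℝ)
    (hp_nonneg : ∀ s a s', 0 ≤ p s a s')
    (hp_sum : ∀ s a, ∑ s', p s a s' = 1)
    (hγ0 : 0 ≤ γ) (hγ1 : γ < 1) (hα : 0 ≤ α)
    (hπ_pos : ∀ k s a, 0 < π k s a)
    (hπ_sum : ∀ k s, ∑ a, π k s a = 1)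
    (hQ : ∀ k, softBellman p r γ α (π k) (Q k) = Q k)
    (himp : ∀ k s,
      ∑ a, π (k + 1) s a * (α * Real.log (π (k + 1) s a) - Q k s a) ≤
        ∑ a, π k s a * (α * Real.log (π k s a) - Q k s a)) :
    (∀ k s a, Q k s a ≤ Q (k + 1) s a) ∧
    (∃ M : ℝ, ∀ k s a, Q k s a ≤ M) ∧
    (∀ s a, ∃ L : ℝ, Filter.Tendsto (fun k => Q k s a) Filter.atTop (nhds L)) := by
  have hfix : ∀ k s a, Q k s a = r s a + γ * ∑ s', p s a s' *
      ∑ a', π k s' a' * (Q k s' a' - α * Real.log (π k s' a')) := by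
    intro k s a
    exact (congrFun (congrFun (hQ k) s) a).symm
  have hmono : ∀ k s a, Q k s a ≤ Q (k + 1) s a := by
    intro k
    have key := aux_max p γ 0 (π (k + 1)) (fun s a => Q k s a - Q (k + 1) s a)
      hp_nonneg hp_sum hγ0 hγ1 (hπ_pos _) (hπ_sum _) ?_
    · intro s a
      have := key s a
      rw [zero_div] at this
      linarith
    · intro s a
      have e1 := hfix k s a
      have e2 := hfix (k + 1) s a
      have h : ∑ s', p s a s' * ∑ a', π k s' a' * (Q k s' a' - α * Real.log (π k s' a')) ≤
          ∑ s', p s a s' * ∑ a', π (k + 1) s' a' * (Q (k + 1) s' a' -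
            α * Real.log (π (k + 1) s' a')) +
          ∑ s', p s a s' * ∑ a', π (k + 1) s' a' * (Q k s' a' - Q (k + 1) s' a') := by
        rw [← Finset.sum_add_distrib]
        refine Finset.sum_le_sum fun s' _ => ?_
        rw [← mul_add, ← Finset.sum_add_distrib]
        refine mul_le_mul_of_nonneg_left ?_ (hp_nonneg s a s')
        have h := neg_le_neg (himp k s')
        rw [← Finset.sum_neg_distrib, ← Finset.sum_neg_distrib] at h
        calc _ = _ := Finset.sum_congr rfl fun a' _ => by ring
          _ ≤ _ := h
          _ = _ := Finset.sum_congr rfl fun a' _ => by ring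
      have h' := mul_le_mul_of_nonneg_left h hγ0
      linarith
  have hbdd : ∃ M : ℝ, ∀ k s a, Q k s a ≤ M := by
    obtain ⟨⟨s0, a0⟩, h0⟩ := Finite.exists_max (fun x : S × A => r x.1 x.2)
    refine ⟨(r s0 a0 + γ * (α * Fintype.card A)) / (1 - γ), fun k => ?_⟩
    refine aux_max p γ _ (π k) (Q k) hp_nonneg hp_sum hγ0 hγ1 (hπ_pos _) (hπ_sum _) ?_
    intro s a
    have h1 : ∀ s', ∑ a', π k s' a' * (Q k s' a' - α * Real.log (π k s' a')) ≤
        α * Fintype.card A + ∑ a', π k s' a' * Q k s' a' := by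
      intro s'
      have : α * (Fintype.card A : ℝ) = ∑ _a' : A, α := by
        simp [mul_comm]
      rw [this, ← Finset.sum_add_distrib]
      refine Finset.sum_le_sum fun a' _ => ?_
      have hx := hπ_pos k s' a'
      have hl := mul_le_mul_of_nonneg_left (Real.one_sub_inv_le_log_of_pos hx) hx.le
      rw [mul_sub, mul_inv_cancel₀ hx.ne'] at hl
      have h2 : 0 ≤ α * (π k s' a' * Real.log (π k s' a') + 1) :=
        mul_nonneg hα (by linarith)
      linarith
    have h2 : ∑ s', p s a s' * ∑ a', π k s' a' * (Q k s' a' - α * Real.log (π k s' a')) ≤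
        α * Fintype.card A + ∑ s', p s a s' * ∑ a', π k s' a' * Q k s' a' := by
      calc _ ≤ ∑ s', p s a s' * (α * Fintype.card A + ∑ a', π k s' a' * Q k s' a') :=
            Finset.sum_le_sum fun s' _ =>
              mul_le_mul_of_nonneg_left (h1 s') (hp_nonneg s a s')
        _ = _ := by
            simp only [mul_add, Finset.sum_add_distrib]
            rw [← Finset.sum_mul, hp_sum, one_mul]
    have h3 := mul_le_mul_of_nonneg_left h2 hγ0
    have h4 := h0 (s, a)
    simp only at h4
    rw [hfix k s a]
    linarith
  refine ⟨hmono, hbdd, fun s a => ?_⟩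
  obtain ⟨M, hM⟩ := hbdd
  exact ⟨_, tendsto_atTop_ciSup (monotone_nat_of_le_succ fun k => hmono k s a)
    ⟨M, by rintro _ ⟨k, rfl⟩; exact hM k s a⟩⟩
end

section
/- (Soft Policy Iteration, optimality part) Let Π be a set of full-support policies and let π* ∈ Π be a policy such that for every π ∈ Π and every state s, ∑_a π*(a|s)·(α log π*(a|s) − Q^{π*}(s,a)) ≤ ∑_a π(a|s)·(α log π(a|s) − Q^{π*}(s,a)). Then Q^{π*}(s,a) ≥ Q^{π}(s,a) for every π ∈ Π and all (s,a) ∈ S × A. -/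
open scoped BigOperators

/-- Soft Policy Iteration, optimality part: if `π⋆ ∈ Π` minimizes, for every
state, the soft improvement objective against its own soft Q-function `Q^{π⋆}` over all
policies in `Π`, then `Q^{π⋆} ≥ Q^π` for every `π ∈ Π`.  Here `Qof π` denotes the soft
Q-function of `π`, i.e. the fixed point of `T^π`, for every `π ∈ Π`, and `Qstar = Qof π⋆`. -/
theorem soft_policy_iteration_optimality
    {S A : Type*} [Fintype S] [Fintype A] [Nonempty S] [Nonempty A]
    (p : S → A → S → ℝ) (r : S → A → ℝ) (γ α : ℝ)
    (Pi : Set (S → A → ℝ)) (πstar : S → A → ℝ)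
    (Qof : (S → A → ℝ) → (S → A → ℝ))
    (hp_nonneg : ∀ s a s', 0 ≤ p s a s')
    (hp_sum : ∀ s a, ∑ s', p s a s' = 1)
    (hγ0 : 0 ≤ γ) (hγ1 : γ < 1) (hα : 0 ≤ α)
    (hfull_pos : ∀ π ∈ Pi, ∀ s a, 0 < π s a)
    (hfull_sum : ∀ π ∈ Pi, ∀ s, ∑ a, π s a = 1)
    (hπstar : πstar ∈ Pi)
    (hQof : ∀ π ∈ Pi, softBellman p r γ α π (Qof π) = Qof π)
    (hopt : ∀ π ∈ Pi, ∀ s,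
      ∑ a, πstar s a * (α * Real.log (πstar s a) - Qof πstar s a) ≤
        ∑ a, π s a * (α * Real.log (π s a) - Qof πstar s a)) :
    ∀ π ∈ Pi, ∀ s a, Qof π s a ≤ Qof πstar s a := by
  intro π hπ
  obtain ⟨⟨s0, a0⟩, hmax⟩ :=
    Finite.exists_max (fun x : S × A => Qof π x.1 x.2 - Qof πstar x.1 x.2)
  set D := Qof π s0 a0 - Qof πstar s0 a0 with hD
  have hle : ∀ s a, Qof π s a ≤ Qof πstar s a + D := by
    intro s a
    have h := hmax (s, a)
    simp only at h
    linarith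
  have hV : ∀ s, ∑ a, π s a * (Qof π s a - α * Real.log (π s a)) ≤
      ∑ a, πstar s a * (Qof πstar s a - α * Real.log (πstar s a)) + D := by
    intro s
    have h1 : ∑ a, π s a * (Qof π s a - α * Real.log (π s a)) ≤
        ∑ a, (D * π s a - π s a * (α * Real.log (π s a) - Qof πstar s a)) := by
      apply Finset.sum_le_sum
      intro a _
      have := mul_le_mul_of_nonneg_left (hle s a) (hfull_pos π hπ s a).le
      linarith
    have h2 : ∑ a, πstar s a * (Qof πstar s a - α * Real.log (πstar s a)) =
        - ∑ a, πstar s a * (α * Real.log (πstar s a) - Qof πstar s a) := by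
      rw [← Finset.sum_neg_distrib]
      apply Finset.sum_congr rfl
      intro a _
      ring
    rw [Finset.sum_sub_distrib, ← Finset.mul_sum, hfull_sum π hπ s] at h1
    have h3 := hopt π hπ s
    linarith
  have hstep : D ≤ γ * D := by
    have e1 := congrFun (congrFun (hQof π hπ) s0) a0
    have e2 := congrFun (congrFun (hQof πstar hπstar) s0) a0
    simp only [softBellman] at e1 e2
    have h4 : ∑ s', p s0 a0 s' * ∑ a', π s' a' * (Qof π s' a' - α * Real.log (π s' a')) ≤
        ∑ s', (p s0 a0 s' * ∑ a', πstar s' a' *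
          (Qof πstar s' a' - α * Real.log (πstar s' a')) + p s0 a0 s' * D) := by
      apply Finset.sum_le_sum
      intro s' _
      rw [← mul_add]
      exact mul_le_mul_of_nonneg_left (hV s') (hp_nonneg s0 a0 s')
    rw [Finset.sum_add_distrib, ← Finset.sum_mul, hp_sum] at h4
    have h5 := mul_le_mul_of_nonneg_left h4 hγ0
    linarith
  have hD0 : D ≤ 0 := by nlinarith
  intro s a
  linarith [hle s a]
end
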